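/- Let H be a finite dimensional crossed Hopf π-coalgebra over a field k with crossing φ. Then there exists a unique group homomorphism φ̂ : π → k \ {0} such that for every left or right π-integral λ = (λ_α)_{α∈π} for H, one has λ_{βαβ⁻¹} ∘ φ_β = φ̂(β)·λ_α for all α, β ∈ π. -/

import Mathlib

open scoped TensorProduct

noncomputable section

/-- Transport of the algebra structure along an equality of group indices. -/
def gcast (k : Type*) [CommSemiring k] {π : Type*} (H : π → Type*)
    [∀ α, Ring (H α)] [∀ α, Algebra k (H α)] {a b : π} (h : a = b) :
    H a ≃ₐ[k] H b := by subst h; exact AlgEquiv.refl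

/-- Transport of a module family along an equality of group indices. -/
def fcast (k : Type*) [CommSemiring k] {π : Type*} (M : π → Type*)
    [∀ α, AddCommGroup (M α)] [∀ α, Module k (M α)] {a b : π} (h : a = b) :
    M a ≃ₗ[k] M b := by subst h; exact LinearEquiv.refl k (M a)

/-- A Hopf `π`-coalgebra (in the sense of Turaev/Virelizier) over a field `k`:
a family of `k`-algebras `H α` with comultiplication `Δ`, counit `ε` and antipode `S`. -/
class HopfGCoalgebra (k : Type*) [Field k] {π : Type*} [Group π]
    (H : π → Type*) [∀ α, Ring (H α)] [∀ α, Algebra k (H α)] where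
  Δ : ∀ α β : π, H (α * β) →ₐ[k] H α ⊗[k] H β
  ε : H (1 : π) →ₐ[k] k
  S : ∀ α : π, H α →ₗ[k] H α⁻¹
  coassoc : ∀ α β γ : π,
    (TensorProduct.assoc k (H α) (H β) (H γ)).toLinearMap ∘ₗ
        (TensorProduct.map (Δ α β).toLinearMap (LinearMap.id : H γ →ₗ[k] H γ)) ∘ₗ
        (Δ (α * β) γ).toLinearMap
      = (TensorProduct.map (LinearMap.id : H α →ₗ[k] H α) (Δ β γ).toLinearMap) ∘ₗ
        (Δ α (β * γ)).toLinearMap ∘ₗ (gcast k H (mul_assoc α β γ)).toLinearMap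
  counit_right : ∀ α : π,
    (TensorProduct.rid k (H α)).toLinearMap ∘ₗ
        (TensorProduct.map (LinearMap.id : H α →ₗ[k] H α) ε.toLinearMap) ∘ₗ
        (Δ α 1).toLinearMap ∘ₗ (gcast k H (mul_one α).symm).toLinearMap = LinearMap.id
  counit_left : ∀ α : π,
    (TensorProduct.lid k (H α)).toLinearMap ∘ₗ
        (TensorProduct.map ε.toLinearMap (LinearMap.id : H α →ₗ[k] H α)) ∘ₗ
        (Δ 1 α).toLinearMap ∘ₗ (gcast k H (one_mul α).symm).toLinearMap = LinearMap.id
  antipode_left : ∀ α : π,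
    (LinearMap.mul' k (H α)) ∘ₗ
        (TensorProduct.map ((gcast k H (inv_inv α)).toLinearMap ∘ₗ S α⁻¹)
          (LinearMap.id : H α →ₗ[k] H α)) ∘ₗ (Δ α⁻¹ α).toLinearMap
      = (Algebra.linearMap k (H α)) ∘ₗ ε.toLinearMap ∘ₗ
        (gcast k H (inv_mul_cancel α)).toLinearMap
  antipode_right : ∀ α : π,
    (LinearMap.mul' k (H α)) ∘ₗ
        (TensorProduct.map (LinearMap.id : H α →ₗ[k] H α)
          ((gcast k H (inv_inv α)).toLinearMap ∘ₗ S α⁻¹)) ∘ₗ (Δ α α⁻¹).toLinearMap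
      = (Algebra.linearMap k (H α)) ∘ₗ ε.toLinearMap ∘ₗ
        (gcast k H (mul_inv_cancel α)).toLinearMap

namespace HopfGCoalgebra

variable (k : Type*) [Field k] {π : Type*} [Group π] (H : π → Type*)
  [∀ α, Ring (H α)] [∀ α, Algebra k (H α)] [HopfGCoalgebra k H]

/-- A left `π`-integral for `H`. -/
def IsLeftIntegral (lam : ∀ α : π, H α →ₗ[k] k) : Prop :=
  ∀ (α β : π) (x : H (α * β)),
    (TensorProduct.rid k (H α))
        (TensorProduct.map (LinearMap.id : H α →ₗ[k] H α) (lam β) (Δ α β x))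
      = lam (α * β) x • (1 : H α)

/-- A right `π`-integral for `H`. -/
def IsRightIntegral (lam : ∀ α : π, H α →ₗ[k] k) : Prop :=
  ∀ (α β : π) (x : H (α * β)),
    (TensorProduct.lid k (H β))
        (TensorProduct.map (lam α) (LinearMap.id : H β →ₗ[k] H β) (Δ α β x))
      = lam (α * β) x • (1 : H β)

/-- A `π`-grouplike element of `H`. -/
def IsGrouplike (g : ∀ α : π, H α) : Prop :=
  (∀ α β : π, Δ α β (g (α * β)) = g α ⊗ₜ[k] g β) ∧ ε (k := k) (H := H) (g 1) = 1

/-- `g` is the distinguished `π`-grouplike element of `H`. -/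
def IsDistinguishedGrouplike (g : ∀ α : π, H α) : Prop :=
  IsGrouplike k H g ∧
    ∀ lam : ∀ α : π, H α →ₗ[k] k, IsRightIntegral k H lam →
      ∀ (α β : π) (x : H (α * β)),
        (TensorProduct.rid k (H α))
            (TensorProduct.map (LinearMap.id : H α →ₗ[k] H α) (lam β) (Δ α β x))
          = lam (α * β) x • g α

/-- `ν` is the distinguished grouplike element of `H₁*`. -/
def IsDistinguishedNu (ν : H (1 : π) →ₐ[k] k) : Prop :=
  ∀ Λ : H (1 : π), (∀ x : H (1 : π), x * Λ = ε (k := k) (H := H) x • Λ) →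
    ∀ x : H (1 : π), Λ * x = ν x • Λ

/-- The right action `a ↼ f` of `f ∈ H₁*` on `a ∈ H α`. -/
def hitR (f : H (1 : π) →ₗ[k] k) {α : π} (a : H α) : H α :=
  (TensorProduct.lid k (H α))
    (TensorProduct.map f (LinearMap.id : H α →ₗ[k] H α)
      (Δ 1 α ((gcast k H (one_mul α).symm) a)))

/-- The left action `f ⇀ a` of `f ∈ H₁*` on `a ∈ H α`. -/
def hitL (f : H (1 : π) →ₗ[k] k) {α : π} (a : H α) : H α :=
  (TensorProduct.rid k (H α))
    (TensorProduct.map (LinearMap.id : H α →ₗ[k] H α) f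
      (Δ α 1 ((gcast k H (mul_one α).symm) a)))


/-- The comultiplication, with all arguments explicit. -/
def comul (α β : π) : H (α * β) →ₐ[k] H α ⊗[k] H β := Δ α β

/-- The counit, with all arguments explicit. -/
def counit : H (1 : π) →ₐ[k] k := ε

/-- The antipode, with all arguments explicit. -/
def antipode (α : π) : H α →ₗ[k] H α⁻¹ := S α

end HopfGCoalgebra

open HopfGCoalgebra
/-- A right Hopf `π`-comodule over `H`. -/
class HopfGComodule (k : Type*) [Field k] {π : Type*} [Group π]
    (H : π → Type*) [∀ α, Ring (H α)] [∀ α, Algebra k (H α)] [HopfGCoalgebra k H]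
    (M : π → Type*) [∀ α, AddCommGroup (M α)] [∀ α, Module k (M α)] where
  ρ : ∀ α β : π, M (α * β) →ₗ[k] M α ⊗[k] H β
  ρ_coassoc : ∀ α β γ : π,
    (TensorProduct.assoc k (M α) (H β) (H γ)).toLinearMap ∘ₗ
        (TensorProduct.map (ρ α β) (LinearMap.id : H γ →ₗ[k] H γ)) ∘ₗ (ρ (α * β) γ)
      = (TensorProduct.map (LinearMap.id : M α →ₗ[k] M α) (Δ β γ).toLinearMap) ∘ₗ
        (ρ α (β * γ)) ∘ₗ (fcast k M (mul_assoc α β γ)).toLinearMap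
  ρ_counit : ∀ α : π,
    (TensorProduct.rid k (M α)).toLinearMap ∘ₗ
        (TensorProduct.map (LinearMap.id : M α →ₗ[k] M α)
          (ε (k := k) (H := H)).toLinearMap) ∘ₗ
        (ρ α 1) ∘ₗ (fcast k M (mul_one α).symm).toLinearMap = LinearMap.id
  act : ∀ α : π, M α →ₗ[k] H α →ₗ[k] M α
  act_one : ∀ (α : π) (m : M α), act α m 1 = m
  act_mul : ∀ (α : π) (m : M α) (a b : H α), act α (act α m a) b = act α m (a * b)
  ρ_act : ∀ (α β : π) (m : M (α * β)) (a : H (α * β)),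
    ρ α β (act (α * β) m a)
      = TensorProduct.map (TensorProduct.lift (act α)) (LinearMap.mul' k (H β))
          ((TensorProduct.tensorTensorTensorComm k (M α) (H β) (H α) (H β))
            (ρ α β m ⊗ₜ[k] (Δ α β a)))

namespace HopfGComodule

variable (k : Type*) [Field k] {π : Type*} [Group π] (H : π → Type*)
  [∀ α, Ring (H α)] [∀ α, Algebra k (H α)] [HopfGCoalgebra k H]
  (M : π → Type*) [∀ α, AddCommGroup (M α)] [∀ α, Module k (M α)] [HopfGComodule k H M]

/-- The submodule of coinvariant families of `H` on `M`. -/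
def coinvFam : Submodule k (∀ α, M α) where
  carrier := {m | ∀ α β : π, ρ (H := H) α β (m (α * β)) = m α ⊗ₜ[k] (1 : H β)}
  add_mem' := by
    intro a b ha hb α β
    simp only [Pi.add_apply, map_add, ha α β, hb α β, TensorProduct.add_tmul]
  zero_mem' := by
    intro α β
    simp only [Pi.zero_apply, map_zero, TensorProduct.zero_tmul]
  smul_mem' := by
    intro c a ha α β
    simp only [Pi.smul_apply, map_smul, ha α β, TensorProduct.smul_tmul']

/-- The `α`-component of the `π`-subcomodule of coinvariants. -/
def coinvSub (α : π) : Submodule k (M α) :=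
  (coinvFam k H M).map (LinearMap.proj α : (∀ γ, M γ) →ₗ[k] M α)


/-- The comodule structure maps, with all arguments explicit. -/
def coact (α β : π) : M (α * β) →ₗ[k] M α ⊗[k] H β := ρ α β

/-- The right `H α`-action on `M α`, with all arguments explicit. -/
def hact (α : π) : M α →ₗ[k] H α →ₗ[k] M α := act α

end HopfGComodule

section Cosemisimple

variable (k : Type*) [Field k] {π : Type*} [Group π] (H : π → Type*)
  [∀ α, Ring (H α)] [∀ α, Algebra k (H α)]
  (M : π → Type*) [∀ α, AddCommGroup (M α)] [∀ α, Module k (M α)]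

/-- `N` is a `π`-subcomodule of the right `π`-comodule `(M, ρ)` over `H`. -/
def IsGSubcomodule (ρ : ∀ α β : π, M (α * β) →ₗ[k] M α ⊗[k] H β)
    (N : ∀ α, Submodule k (M α)) : Prop :=
  ∀ (α β : π), ∀ x ∈ N (α * β),
    ρ α β x ∈ LinearMap.range
      (TensorProduct.map (N α).subtype (LinearMap.id : H β →ₗ[k] H β))

/-- `N` is a simple `π`-subcomodule of `(M, ρ)`. -/
def IsSimpleGSubcomodule (ρ : ∀ α β : π, M (α * β) →ₗ[k] M α ⊗[k] H β)
    (N : ∀ α, Submodule k (M α)) : Prop :=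
  IsGSubcomodule k H M ρ N ∧ (∃ α, N α ≠ ⊥) ∧
    ∀ P : ∀ α, Submodule k (M α), IsGSubcomodule k H M ρ P → (∀ α, P α ≤ N α) →
      (∀ α, P α = ⊥) ∨ P = N

/-- The right `π`-comodule `(M, ρ)` is cosemisimple: it is the sum of its simple
`π`-subcomodules. -/
def IsGCosemisimple (ρ : ∀ α β : π, M (α * β) →ₗ[k] M α ⊗[k] H β) : Prop :=
  ∀ α : π,
    (⨆ N : {N : ∀ γ, Submodule k (M γ) // IsSimpleGSubcomodule k H M ρ N}, N.1 α) = ⊤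

end Cosemisimple

section CoalgCosemisimple

variable (k : Type*) [Field k] (C : Type*) [AddCommGroup C] [Module k C]

/-- `N` is a subcomodule of the coalgebra `(C, δ)` viewed as a right comodule over itself. -/
def IsSubcoideal (δ : C →ₗ[k] C ⊗[k] C) (N : Submodule k C) : Prop :=
  ∀ x ∈ N, δ x ∈ LinearMap.range (TensorProduct.map N.subtype (LinearMap.id : C →ₗ[k] C))

def IsSimpleSubcoideal (δ : C →ₗ[k] C ⊗[k] C) (N : Submodule k C) : Prop :=
  IsSubcoideal k C δ N ∧ N ≠ ⊥ ∧
    ∀ P : Submodule k C, IsSubcoideal k C δ P → P ≤ N → P = ⊥ ∨ P = N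

/-- The coalgebra `(C, δ)` is cosemisimple. -/
def IsCosemisimpleCoalgebra (δ : C →ₗ[k] C ⊗[k] C) : Prop :=
  (⨆ N : {N : Submodule k C // IsSimpleSubcoideal k C δ N}, N.1) = ⊤

end CoalgCosemisimple
/-- A crossed Hopf `π`-coalgebra: a Hopf `π`-coalgebra with a crossing `φ`. -/
class CrossedHopfGCoalgebra (k : Type*) [Field k] {π : Type*} [Group π]
    (H : π → Type*) [∀ α, Ring (H α)] [∀ α, Algebra k (H α)]
    extends HopfGCoalgebra k H where
  φ : ∀ β α : π, H α ≃ₐ[k] H (β * α * β⁻¹)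
  φ_comul : ∀ β α γ : π,
    (TensorProduct.map (φ β α).toLinearMap (φ β γ).toLinearMap) ∘ₗ (Δ α γ).toLinearMap
      = (Δ (β * α * β⁻¹) (β * γ * β⁻¹)).toLinearMap ∘ₗ
        (gcast k H (show β * (α * γ) * β⁻¹ = (β * α * β⁻¹) * (β * γ * β⁻¹) by
          group)).toLinearMap ∘ₗ (φ β (α * γ)).toLinearMap
  φ_counit : ∀ (β : π) (x : H (1 : π)),
    ε ((gcast k H (show β * 1 * β⁻¹ = (1 : π) by group)) (φ β 1 x)) = ε x
  φ_mul : ∀ (β β' α : π) (x : H α),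
    (gcast k H (show β * (β' * α * β'⁻¹) * β⁻¹ = (β * β') * α * (β * β')⁻¹ by group))
        (φ β (β' * α * β'⁻¹) (φ β' α x))
      = φ (β * β') α x


namespace CrossedHopfGCoalgebra

variable (k : Type*) [Field k] {π : Type*} [Group π] (H : π → Type*)
  [∀ α, Ring (H α)] [∀ α, Algebra k (H α)] [CrossedHopfGCoalgebra k H]

/-- The crossing, with all arguments explicit. -/
def crossing (β α : π) : H α ≃ₐ[k] H (β * α * β⁻¹) := φ β α

end CrossedHopfGCoalgebra

open CrossedHopfGCoalgebra

/-- A quasitriangular Hopf `π`-coalgebra: a crossed Hopf `π`-coalgebra with an R-matrix. -/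
class QTHopfGCoalgebra (k : Type*) [Field k] {π : Type*} [Group π]
    (H : π → Type*) [∀ α, Ring (H α)] [∀ α, Algebra k (H α)]
    extends CrossedHopfGCoalgebra k H where
  Rm : ∀ α β : π, H α ⊗[k] H β
  Rm_isUnit : ∀ α β : π, IsUnit (Rm α β)
  Rm_comul : ∀ (α β : π) (x : H (α * β)),
    Rm α β * Δ α β x
      = (TensorProduct.comm k (H β) (H α))
          ((TensorProduct.map
              ((gcast k H (show α⁻¹ * (α * β * α⁻¹) * α⁻¹⁻¹ = β by group)).toLinearMap ∘ₗ
                (φ α⁻¹ (α * β * α⁻¹)).toLinearMap)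
              (LinearMap.id : H α →ₗ[k] H α))
            ((Δ (α * β * α⁻¹) α)
              ((gcast k H (show α * β = (α * β * α⁻¹) * α by group)) x))) * Rm α β
  Rm_delta_right : ∀ α β γ : π,
    TensorProduct.map (LinearMap.id : H α →ₗ[k] H α) (Δ β γ).toLinearMap (Rm α (β * γ))
      = (TensorProduct.map (LinearMap.id : H α →ₗ[k] H α)
            (TensorProduct.mk k (H β) (H γ) 1) (Rm α γ))
        * (TensorProduct.map (LinearMap.id : H α →ₗ[k] H α)
            ((TensorProduct.mk k (H β) (H γ)).flip 1) (Rm α β))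
  Rm_delta_left : ∀ α β γ : π,
    (TensorProduct.assoc k (H α) (H β) (H γ))
        (TensorProduct.map (Δ α β).toLinearMap (LinearMap.id : H γ →ₗ[k] H γ)
          (Rm (α * β) γ))
      = (TensorProduct.map (LinearMap.id : H α →ₗ[k] H α)
            (TensorProduct.mk k (H β) (H γ) 1)
            (TensorProduct.map (LinearMap.id : H α →ₗ[k] H α)
              ((gcast k H (show β⁻¹ * (β * γ * β⁻¹) * β⁻¹⁻¹ = γ by group)).toLinearMap ∘ₗ
                (φ β⁻¹ (β * γ * β⁻¹)).toLinearMap)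
              (Rm α (β * γ * β⁻¹))))
        * (TensorProduct.mk k (H α) (H β ⊗[k] H γ) 1 (Rm β γ))
  Rm_phi : ∀ β α γ : π,
    TensorProduct.map (φ β α).toLinearMap (φ β γ).toLinearMap (Rm α γ)
      = Rm (β * α * β⁻¹) (β * γ * β⁻¹)

namespace QTHopfGCoalgebra

variable (k : Type*) [Field k] {π : Type*} [Group π] (H : π → Type*)
  [∀ α, Ring (H α)] [∀ α, Algebra k (H α)] [QTHopfGCoalgebra k H]

/-- The square of the antipode `S_{α⁻¹} ∘ S_α : H α → H α`. -/
def antipodeSq (α : π) : H α →ₗ[k] H α :=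
  (gcast k H (inv_inv α)).toLinearMap ∘ₗ S α⁻¹ ∘ₗ S α

/-- The map `S_{α⁻¹} ∘ φ_α : H (α⁻¹) → H α`. -/
def sphi (α : π) : H α⁻¹ →ₗ[k] H α :=
  (gcast k H (inv_inv α)).toLinearMap ∘ₗ S α⁻¹ ∘ₗ
    (gcast k H (show α * α⁻¹ * α⁻¹ = α⁻¹ by group)).toLinearMap ∘ₗ
    (φ α α⁻¹).toLinearMap

/-- The Drinfeld element `u_α = m_α ∘ (S_{α⁻¹}φ_α ⊗ id) ∘ σ_{α,α⁻¹} (R_{α,α⁻¹})`. -/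
def drinfeld (α : π) : H α :=
  LinearMap.mul' k (H α)
    (TensorProduct.map (sphi k H α) (LinearMap.id : H α →ₗ[k] H α)
      ((TensorProduct.comm k (H α) (H α⁻¹)) (Rm α α⁻¹)))

/-- The element `S_{α⁻¹}(u_{α⁻¹}) ∈ H α`. -/
def sdrinfeld (α : π) : H α :=
  (gcast k H (inv_inv α)) (S (k := k) (H := H) α⁻¹ (drinfeld k H α⁻¹))

/-- The `π`-grouplike element `ℓ_α = S_{α⁻¹}(u_{α⁻¹})⁻¹ u_α`. -/
def ell (α : π) : H α :=
  Ring.inverse (sdrinfeld k H α) * drinfeld k H α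


/-- The R-matrix, with all arguments explicit. -/
def rmatrix (α β : π) : H α ⊗[k] H β := Rm α β

end QTHopfGCoalgebra

open QTHopfGCoalgebra


section HopfIntegrals

open Coalgebra HopfAlgebra

variable {k A : Type*} [Field k] [Ring A] [HopfAlgebra k A]

/-- The operator `x ↦ f(x₂) x₁`. -/
def rightSlice (f : A →ₗ[k] k) : A →ₗ[k] A :=
  (TensorProduct.rid k A).toLinearMap ∘ₗ TensorProduct.map LinearMap.id f ∘ₗ Coalgebra.comul

/-- The operator `x ↦ g(x₁) x₂`. -/
def leftSlice (g : A →ₗ[k] k) : A →ₗ[k] A :=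
  (TensorProduct.lid k A).toLinearMap ∘ₗ TensorProduct.map g LinearMap.id ∘ₗ Coalgebra.comul

theorem rightSlice_apply {ι : Type*} (f : A →ₗ[k] k) {x : A} (r : Repr k x ι) :
    rightSlice f x = ∑ i ∈ r.index, f (r.right i) • r.left i := by
  simp [rightSlice, ← r.eq]

theorem leftSlice_apply {ι : Type*} (g : A →ₗ[k] k) {x : A} (r : Repr k x ι) :
    leftSlice g x = ∑ i ∈ r.index, g (r.left i) • r.right i := by
  simp [leftSlice, ← r.eq]

theorem leftSlice_rightSlice_comm (f g : A →ₗ[k] k) (x : A) :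
    leftSlice g (rightSlice f x) = rightSlice f (leftSlice g x) := by
  have h' := congrArg (TensorProduct.lid k A ∘ TensorProduct.map g
    ((TensorProduct.rid k A).toLinearMap ∘ₗ TensorProduct.map LinearMap.id f))
    (coassoc_apply (R := k) x)
  let r := ℛ k x
  rw [rightSlice_apply f r, leftSlice_apply g r, map_sum, map_sum]
  simp only [map_smul]
  rw [← r.eq] at h'
  simp only [map_sum, Function.comp_apply, LinearMap.rTensor_tmul, LinearMap.lTensor_tmul,
    TensorProduct.map_tmul, LinearMap.comp_apply] at h'
  refine Eq.trans ?_ (h'.trans ?_)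
  · refine Finset.sum_congr rfl fun i _ => ?_
    rw [leftSlice_apply g (ℛ k (r.left i))]
    conv_rhs => rw [← (ℛ k (r.left i)).eq]
    simp [TensorProduct.sum_tmul, Finset.smul_sum, smul_smul]
  · simp [rightSlice]

theorem sum_mul_antipode_tmul {ι : Type*} {v : A} (r : Repr k v ι) {κ : ι → Type*}
    (s : ∀ i, Repr k (r.right i) (κ i)) :
    ∑ i ∈ r.index, ∑ l ∈ (s i).index,
      (r.left i * HopfAlgebra.antipode k ((s i).left l)) ⊗ₜ[k] (s i).right l = (1 : A) ⊗ₜ[k] v := by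
  have h := congrArg ((TensorProduct.map (LinearMap.mul' k A ∘ₗ
    TensorProduct.map LinearMap.id (HopfAlgebra.antipode k)) LinearMap.id) ∘
      (TensorProduct.assoc k A A A).symm)
    (sum_tmul_tmul_eq r (fun i => ℛ k (r.left i)) s)
  simp only [Function.comp_apply, map_sum, TensorProduct.assoc_symm_tmul, TensorProduct.map_tmul,
    LinearMap.comp_apply, LinearMap.id_apply, LinearMap.mul'_apply] at h
  rw [← h]
  simp only [← TensorProduct.sum_tmul, sum_mul_antipode_eq_smul, TensorProduct.smul_tmul,
    ← TensorProduct.tmul_sum, sum_counit_smul]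

theorem sum_tmul_antipode_mul {ι : Type*} {v : A} (r : Repr k v ι) {κ : ι → Type*}
    (s : ∀ i, Repr k (r.left i) (κ i)) :
    ∑ i ∈ r.index, ∑ l ∈ (s i).index,
      (s i).left l ⊗ₜ[k] (HopfAlgebra.antipode k ((s i).right l) * r.right i) =
        v ⊗ₜ[k] (1 : A) := by
  have h := congrArg (TensorProduct.map LinearMap.id (LinearMap.mul' k A ∘ₗ
    TensorProduct.map (HopfAlgebra.antipode k) LinearMap.id))
    (sum_tmul_tmul_eq r s (fun i => ℛ k (r.right i)))
  simp only [map_sum, TensorProduct.map_tmul,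
    LinearMap.comp_apply, LinearMap.id_apply, LinearMap.mul'_apply] at h
  rw [h]
  have hr := congrArg (TensorProduct.rid k A) (sum_tmul_counit_eq r)
  simp only [map_sum, TensorProduct.rid_tmul, one_smul] at hr
  simp only [← TensorProduct.tmul_sum, sum_antipode_mul_eq_smul, TensorProduct.tmul_smul,
    TensorProduct.smul_tmul', ← TensorProduct.sum_tmul, hr]

theorem sum_antipode_mul_tmul {ι : Type*} {v : A} (r : Repr k v ι) :
    ∑ i ∈ r.index, (HopfAlgebra.antipode k (r.left i) ⊗ₜ[k] (1 : A)) * Coalgebra.comul (r.right i) =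
      (1 : A) ⊗ₜ[k] v := by
  have h := congrArg ((TensorProduct.map (LinearMap.mul' k A ∘ₗ
    TensorProduct.map (HopfAlgebra.antipode k) LinearMap.id) LinearMap.id) ∘
      (TensorProduct.assoc k A A A).symm)
    (sum_tmul_tmul_eq r (fun i => ℛ k (r.left i)) (fun i => ℛ k (r.right i)))
  simp only [Function.comp_apply, map_sum, TensorProduct.assoc_symm_tmul, TensorProduct.map_tmul,
    LinearMap.comp_apply, LinearMap.id_apply, LinearMap.mul'_apply] at h
  simp only [← TensorProduct.sum_tmul, sum_antipode_mul_eq_smul, TensorProduct.smul_tmul,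
    ← TensorProduct.tmul_sum, sum_counit_smul] at h
  rw [h]
  refine Finset.sum_congr rfl fun i _ => ?_
  conv_lhs => rw [← (ℛ k (r.right i)).eq]
  simp [Finset.mul_sum]

theorem comul_antipode (h : A) :
    Coalgebra.comul (R := k) (HopfAlgebra.antipode k h) =
      TensorProduct.map (HopfAlgebra.antipode k) (HopfAlgebra.antipode k)
        (TensorProduct.comm k A A (Coalgebra.comul h)) := by
  have key :
      WithConv.toConv ((TensorProduct.map (HopfAlgebra.antipode k) (HopfAlgebra.antipode k)) ∘ₗ
      (TensorProduct.comm k A A).toLinearMap ∘ₗ (Coalgebra.comul (R := k) (A := A))) =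
      WithConv.toConv (Coalgebra.comul ∘ₗ HopfAlgebra.antipode k) := by
    refine left_inv_eq_right_inv (a := WithConv.toConv (Coalgebra.comul (R := k) (A := A))) ?_
      LinearMap.comul_right_inv
    ext x
    let r := ℛ k x
    let Ω : A ⊗[k] (A ⊗[k] A) →ₗ[k] A ⊗[k] A :=
      TensorProduct.lift ((LinearMap.mul k (A ⊗[k] A)).compl₂ Coalgebra.comul) ∘ₗ
        TensorProduct.map ((TensorProduct.map (HopfAlgebra.antipode k) (HopfAlgebra.antipode k)) ∘ₗ
          (TensorProduct.comm k A A).toLinearMap) LinearMap.id ∘ₗ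
        (TensorProduct.assoc k A A A).symm.toLinearMap
    have hΩ : ∀ a b c : A, Ω (a ⊗ₜ (b ⊗ₜ c)) =
        (HopfAlgebra.antipode k b ⊗ₜ[k] HopfAlgebra.antipode k a) * Coalgebra.comul c :=
      fun a b c => by simp [Ω]
    have h := congrArg Ω
      (sum_tmul_tmul_eq r (fun i => ℛ k (r.left i)) (fun i => ℛ k (r.right i)))
    simp only [map_sum, hΩ] at h
    have split : ∀ a b c : A,
        (HopfAlgebra.antipode k b ⊗ₜ[k] HopfAlgebra.antipode k a) * Coalgebra.comul c =
        ((1 : A) ⊗ₜ[k] HopfAlgebra.antipode k a) *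
          ((HopfAlgebra.antipode k b ⊗ₜ[k] (1 : A)) * Coalgebra.comul c) :=
      fun a b c => by
      rw [← mul_assoc]; simp
    rw [r.convMul_apply]
    calc _ = _ := ?_
      _ = _ := h
      _ = _ := ?_
    · refine Finset.sum_congr rfl fun i _ => ?_
      simp only [LinearMap.comp_apply, LinearEquiv.coe_coe]
      conv_lhs => rw [← (ℛ k (r.left i)).eq]
      simp [Finset.sum_mul]
    · simp only [split, ← Finset.mul_sum, sum_antipode_mul_tmul]
      simp only [Algebra.TensorProduct.tmul_mul_tmul, mul_one, ← TensorProduct.tmul_sum,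
        sum_antipode_mul_eq_smul]
      simp [Algebra.TensorProduct.one_def, Algebra.algebraMap_eq_smul_one]
  exact (congrArg (fun T => T.ofConv h) key).symm

theorem leftSlice_add (f g : A →ₗ[k] k) : leftSlice (f + g) = leftSlice f + leftSlice g := by
  simp [leftSlice, TensorProduct.map_add_left, LinearMap.comp_add, LinearMap.add_comp]

theorem leftSlice_smul (c : k) (f : A →ₗ[k] k) : leftSlice (c • f) = c • leftSlice f := by
  simp [leftSlice, TensorProduct.map_smul_left, LinearMap.comp_smul, LinearMap.smul_comp]

theorem apply_rightSlice (f g : A →ₗ[k] k) (x : A) :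
    g (rightSlice f x) = f (leftSlice g x) := by
  simp [rightSlice_apply f (ℛ k x), leftSlice_apply g (ℛ k x), mul_comm]

theorem counit_rightSlice (f : A →ₗ[k] k) (x : A) :
    Coalgebra.counit (R := k) (rightSlice f x) = f x := by
  rw [apply_rightSlice, leftSlice_apply _ (ℛ k x), sum_counit_smul]

/-- The antipode reverses the comultiplication. -/
def reprAntipode {ι : Type*} {v : A} (r : Repr k v ι) : Repr k (HopfAlgebra.antipode k v) ι where
  index := r.index
  left i := HopfAlgebra.antipode k (r.right i)
  right i := HopfAlgebra.antipode k (r.left i)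
  eq := by
    rw [comul_antipode, ← r.eq]
    simp

/-- The square of the antipode is compatible with the comultiplication. -/
def reprAntipodeSq {ι : Type*} {v : A} (r : Repr k v ι) :
    Repr k (HopfAlgebra.antipode k (HopfAlgebra.antipode k v)) ι :=
  reprAntipode (reprAntipode r)

section Basis

variable {M : Type*} [AddCommGroup M] [Module k M] {J : Type*} [Fintype J]

theorem sum_basis_leftSlice (b : Module.Basis J k A) (B : A →ₗ[k] A →ₗ[k] M)
    {ι : Type*} {v : A} (r : Repr k v ι) :
    ∑ j, B (b j) (leftSlice (b.coord j) v) = ∑ i ∈ r.index, B (r.left i) (r.right i) := by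
  simp only [leftSlice_apply _ r, map_sum, map_smul]
  rw [Finset.sum_comm]
  refine Finset.sum_congr rfl fun i _ => ?_
  conv_rhs => rw [← b.sum_repr (r.left i)]
  simp only [map_sum, map_smul, LinearMap.sum_apply, LinearMap.smul_apply,
    Module.Basis.coord_apply]

theorem sum_basis_rightSlice (b : Module.Basis J k A) (B : A →ₗ[k] A →ₗ[k] M)
    {ι : Type*} {v : A} (r : Repr k v ι) :
    ∑ j, B (rightSlice (b.coord j) v) (b j) = ∑ i ∈ r.index, B (r.left i) (r.right i) := by
  simp only [rightSlice_apply _ r, map_sum, map_smul, LinearMap.sum_apply, LinearMap.smul_apply]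
  rw [Finset.sum_comm]
  refine Finset.sum_congr rfl fun i _ => ?_
  conv_rhs => rw [← b.sum_repr (r.right i)]
  simp only [map_sum, map_smul, Module.Basis.coord_apply]

theorem sum_leftSlice_mul_antipodeSq (b : Module.Basis J k A) (g : A →ₗ[k] k) (x v : A) :
    ∑ j, leftSlice (g ∘ₗ LinearMap.mulRight k (HopfAlgebra.antipode k (b j)))
        (x * HopfAlgebra.antipode k (HopfAlgebra.antipode k (leftSlice (b.coord j) v))) =
      leftSlice g x * HopfAlgebra.antipode k (HopfAlgebra.antipode k v) := by
  let B : A →ₗ[k] A →ₗ[k] A := LinearMap.mk₂ k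
    (fun a c => leftSlice (g ∘ₗ LinearMap.mulRight k (HopfAlgebra.antipode k a))
      (x * HopfAlgebra.antipode k (HopfAlgebra.antipode k c)))
    (fun a a' c => by
      rw [← LinearMap.add_apply, ← leftSlice_add, ← LinearMap.comp_add]
      congr 3; ext; simp [mul_add])
    (fun t a c => by
      rw [← LinearMap.smul_apply, ← leftSlice_smul, ← LinearMap.comp_smul]
      congr 3; ext; simp)
    (fun a c c' => by simp [mul_add])
    (fun t a c => by simp)
  let r := ℛ k v
  let s := fun i => ℛ k (r.right i)
  let rx := ℛ k x
  refine (sum_basis_leftSlice b B r).trans ?_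
  have hB : ∀ i, B (r.left i) (r.right i) = ∑ m ∈ rx.index, ∑ l ∈ (s i).index,
      g (rx.left m * HopfAlgebra.antipode k (r.left i * HopfAlgebra.antipode k ((s i).left l))) •
        (rx.right m * HopfAlgebra.antipode k (HopfAlgebra.antipode k ((s i).right l))) :=
      fun i => by
    refine (leftSlice_apply _ (rx.mul (reprAntipodeSq (s i)))).trans ?_
    simp [Finset.sum_product, antipode_mul_antidistrib, reprAntipodeSq, reprAntipode,
      mul_assoc]
  simp only [hB]
  rw [Finset.sum_comm, leftSlice_apply g rx, Finset.sum_mul]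
  refine Finset.sum_congr rfl fun m _ => ?_
  have h := congrArg (TensorProduct.lid k A ∘ TensorProduct.map
    (g ∘ₗ LinearMap.mulLeft k (rx.left m) ∘ₗ HopfAlgebra.antipode k)
    (LinearMap.mulLeft k (rx.right m) ∘ₗ HopfAlgebra.antipode k ∘ₗ HopfAlgebra.antipode k))
    (sum_mul_antipode_tmul r s)
  simpa using h

theorem sum_leftSlice_leftSlice (b : Module.Basis J k A) (g : A →ₗ[k] k) (y : A) :
    ∑ j, leftSlice (b.coord j)
        (leftSlice (g ∘ₗ LinearMap.mulRight k (HopfAlgebra.antipode k (b j))) y) = g 1 • y := by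
  let r := ℛ k y
  let s := fun i => ℛ k (r.right i)
  simp only [leftSlice_apply (g ∘ₗ _) r, map_sum, map_smul]
  rw [Finset.sum_comm]
  have h := congrArg (TensorProduct.lid k A ∘ TensorProduct.map g LinearMap.id)
    (sum_mul_antipode_tmul r s)
  simp only [Function.comp_apply, map_sum, TensorProduct.map_tmul, TensorProduct.lid_tmul,
    LinearMap.id_apply] at h
  rw [← h]
  refine Finset.sum_congr rfl fun i _ => ?_
  simpa using sum_basis_leftSlice b
    ((LinearMap.lsmul k A).comp (g ∘ₗ LinearMap.mulLeft k (r.left i) ∘ₗ HopfAlgebra.antipode k))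
    (s i)

end Basis

/-- The functional `x ↦ Tr(K ∘ L_x ∘ S²)`. -/
def traceForm (K : Module.End k A) : A →ₗ[k] k :=
  LinearMap.trace k A ∘ₗ LinearMap.mulLeft k K ∘ₗ
    LinearMap.mulRight k (HopfAlgebra.antipode k * HopfAlgebra.antipode k : Module.End k A) ∘ₗ
      LinearMap.mul k A

theorem traceForm_apply (K : Module.End k A) (x : A) :
    traceForm K x = LinearMap.trace k A
      (K * (LinearMap.mulLeft k x * (HopfAlgebra.antipode k * HopfAlgebra.antipode k : Module.End k A))) :=
    rfl

/-- A left integral on a Hopf algebra. -/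
def IsLeftHopfIntegral (lam : A →ₗ[k] k) : Prop :=
  ∀ x, rightSlice lam x = lam x • (1 : A)

theorem isLeftHopfIntegral_traceForm [FiniteDimensional k A] (K : Module.End k A)
    (hK : ∀ (g : A →ₗ[k] k) (x : A), leftSlice g (K x) = K (leftSlice g x)) :
    IsLeftHopfIntegral (traceForm K) := by
  intro x
  refine sub_eq_zero.1 ((Module.forall_dual_apply_eq_zero_iff k _).1 fun g => ?_)
  rw [map_sub, sub_eq_zero]
  let b := Module.finBasis k A
  let T : Fin (Module.finrank k A) → Module.End k A := fun j => leftSlice (b.coord j)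
  let U : Fin (Module.finrank k A) → Module.End k A :=
    fun j => leftSlice (g ∘ₗ LinearMap.mulRight k (HopfAlgebra.antipode k (b j)))
  let SS : Module.End k A := HopfAlgebra.antipode k * HopfAlgebra.antipode k
  have hK' : ∀ j, T j * K = K * T j := fun j => by ext x; exact hK _ _
  have h₁ : LinearMap.mulLeft k (leftSlice g x) * SS =
      ∑ j, U j * (LinearMap.mulLeft k x * SS) * T j := by
    ext v
    simpa [U, T, SS] using (sum_leftSlice_mul_antipodeSq b g x v).symm
  have h₂ : ∑ j, T j * U j = g 1 • (1 : Module.End k A) := by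
    ext y
    simpa [U, T] using sum_leftSlice_leftSlice b g y
  rw [apply_rightSlice, map_smul, smul_eq_mul, traceForm_apply, traceForm_apply]
  change LinearMap.trace k A (K * (LinearMap.mulLeft k (leftSlice g x) * SS)) =
    LinearMap.trace k A (K * (LinearMap.mulLeft k x * SS)) * g 1
  rw [h₁, Finset.mul_sum, map_sum]
  have h₃ : ∀ j, LinearMap.trace k A (K * (U j * (LinearMap.mulLeft k x * SS) * T j)) =
      LinearMap.trace k A (K * (T j * U j) * (LinearMap.mulLeft k x * SS)) := fun j => by
    rw [← mul_assoc, LinearMap.trace_mul_comm, ← mul_assoc, hK']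
    simp only [mul_assoc]
  simp only [h₃]
  rw [← map_sum, ← Finset.sum_mul, ← Finset.mul_sum, h₂]
  simp [mul_comm]

theorem exists_isLeftHopfIntegral_ne_zero [FiniteDimensional k A] :
    ∃ lam : A →ₗ[k] k, IsLeftHopfIntegral lam ∧ lam ≠ 0 := by
  by_contra! hzero
  let b := Module.finBasis k A
  let SS : Module.End k A := HopfAlgebra.antipode k * HopfAlgebra.antipode k
  let E : Module.End k A := rightSlice Coalgebra.counit
  let R : Fin (Module.finrank k A) → Module.End k A := fun j => rightSlice (b.coord j)
  have h₀ : ∀ j, traceForm (R j * E) = 0 := fun j => hzero _ <|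
    isLeftHopfIntegral_traceForm _ fun g x => by
      simp [R, E, leftSlice_rightSlice_comm]
  have h₁ : ∑ j, LinearMap.mulLeft k (HopfAlgebra.antipode k (b j)) * SS * R j =
      (Coalgebra.counit (R := k) (A := A)).smulRight (1 : A) := by
    ext v
    let B : A →ₗ[k] A →ₗ[k] A := (LinearMap.mul k A).flip.compl₁₂ SS (HopfAlgebra.antipode k)
    have h := sum_basis_rightSlice b B (ℛ k v)
    have h' := congrArg (HopfAlgebra.antipode k) (sum_antipode_mul_eq_smul (ℛ k v))
    simp only [map_sum, antipode_mul_antidistrib, map_smul, antipode_one] at h'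
    simp only [B, LinearMap.compl₁₂_apply, LinearMap.flip_apply, LinearMap.mul_apply'] at h
    simpa [R] using h.trans h'
  have h₂ : ∑ j, traceForm (R j * E) (HopfAlgebra.antipode k (b j)) = 1 := by
    simp only [traceForm_apply]
    have : ∀ j, LinearMap.trace k A (R j * E * (LinearMap.mulLeft k (HopfAlgebra.antipode k (b j)) *
        (HopfAlgebra.antipode k * HopfAlgebra.antipode k : Module.End k A))) =
        LinearMap.trace k A
          (E * (LinearMap.mulLeft k (HopfAlgebra.antipode k (b j)) * SS * R j)) := by
      intro j
      rw [mul_assoc, LinearMap.trace_mul_comm]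
      simp only [SS, mul_assoc]
    simp only [this]
    rw [← map_sum, ← Finset.mul_sum, h₁, LinearMap.trace_mul_comm]
    have : (Coalgebra.counit (R := k) (A := A)).smulRight (1 : A) * E =
        (Coalgebra.counit (R := k) (A := A)).smulRight (1 : A) := by
      ext v
      simp [E, counit_rightSlice]
    rw [this, LinearMap.trace_smulRight, Bialgebra.counit_one]
  simp [h₀] at h₂

theorem IsLeftHopfIntegral.rightSlice_mul_antipode {lam : A →ₗ[k] k}
    (hlam : IsLeftHopfIntegral lam) (h y : A) {ι : Type*} (r : Repr k h ι) :
    rightSlice (lam ∘ₗ LinearMap.mulRight k (HopfAlgebra.antipode k h)) y =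
      ∑ i ∈ r.index, lam (y * HopfAlgebra.antipode k (r.left i)) • r.right i := by
  let s := fun i => ℛ k (r.left i)
  let ry := ℛ k y
  have hi : ∀ i, lam (y * HopfAlgebra.antipode k (r.left i)) • r.right i = ∑ m ∈ ry.index,
      ∑ l ∈ (s i).index, lam (ry.right m * HopfAlgebra.antipode k ((s i).left l)) •
        (ry.left m * (HopfAlgebra.antipode k ((s i).right l) * r.right i)) := fun i => by
    rw [← one_mul (r.right i), ← smul_mul_assoc, ← hlam,
      rightSlice_apply lam (ry.mul (reprAntipode (s i)))]
    simp [Finset.sum_product, reprAntipode, mul_assoc, Finset.sum_mul]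
  simp only [hi]
  rw [Finset.sum_comm, rightSlice_apply _ ry]
  refine Finset.sum_congr rfl fun m _ => ?_
  have h' := congrArg (TensorProduct.lid k A ∘ TensorProduct.map
    (lam ∘ₗ LinearMap.mulLeft k (ry.right m) ∘ₗ HopfAlgebra.antipode k)
    (LinearMap.mulLeft k (ry.left m))) (sum_tmul_antipode_mul r s)
  simpa using h'.symm

theorem IsLeftHopfIntegral.traceForm_mul_antipode [FiniteDimensional k A]
    {lam : A →ₗ[k] k} (hlam : IsLeftHopfIntegral lam) (p : A →ₗ[k] k) (h x : A) :
    traceForm (rightSlice p * rightSlice (lam ∘ₗ LinearMap.mulRight k (HopfAlgebra.antipode k h)) :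
      Module.End k A) x = p h * lam x := by
  let r := ℛ k h
  let s := fun i => ℛ k (r.right i)
  have hop : (rightSlice p * rightSlice (lam ∘ₗ LinearMap.mulRight k (HopfAlgebra.antipode k h)) *
      (LinearMap.mulLeft k x * (HopfAlgebra.antipode k * HopfAlgebra.antipode k))
        : Module.End k A) =
      ∑ i ∈ r.index, (lam ∘ₗ LinearMap.mulRight k (HopfAlgebra.antipode k (r.left i)) ∘ₗ
        LinearMap.mulLeft k x ∘ₗ HopfAlgebra.antipode k ∘ₗ HopfAlgebra.antipode k).smulRight
          (rightSlice p (r.right i)) := by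
    ext u
    simp [hlam.rightSlice_mul_antipode h _ r]
  rw [traceForm_apply, hop, map_sum]
  simp only [LinearMap.trace_smulRight]
  have h' := congrArg (LinearMap.mul' k k ∘ TensorProduct.map
    (lam ∘ₗ LinearMap.mulLeft k x ∘ₗ HopfAlgebra.antipode k) p) (sum_mul_antipode_tmul r s)
  simp only [Function.comp_apply, map_sum, TensorProduct.map_tmul, LinearMap.mul'_apply,
    LinearMap.comp_apply, LinearMap.mulLeft_apply, antipode_one, mul_one] at h'
  rw [mul_comm, ← h']
  refine Finset.sum_congr rfl fun i _ => ?_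
  simp [rightSlice_apply p (s i), antipode_mul_antidistrib, mul_assoc, mul_comm (p _)]

theorem IsLeftHopfIntegral.eq_zero_of_mul_antipode [FiniteDimensional k A]
    {lam : A →ₗ[k] k} (hlam : IsLeftHopfIntegral lam) (hne : lam ≠ 0) {h : A}
    (hh : lam ∘ₗ LinearMap.mulRight k (HopfAlgebra.antipode k h) = 0) : h = 0 := by
  obtain ⟨x, hx⟩ : ∃ x, lam x ≠ 0 := by
    by_contra! hx
    exact hne (LinearMap.ext hx)
  refine (Module.forall_dual_apply_eq_zero_iff k h).1 fun p => ?_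
  have key := hlam.traceForm_mul_antipode p h x
  rw [hh] at key
  have h0 : rightSlice (0 : A →ₗ[k] k) = 0 := by
    ext y; simp [rightSlice_apply _ (ℛ k y)]
  simpa [h0, traceForm_apply, hx] using key.symm

theorem IsLeftHopfIntegral.exists_eq_smul [FiniteDimensional k A]
    {lam mu : A →ₗ[k] k} (hlam : IsLeftHopfIntegral lam) (hne : lam ≠ 0)
    (hmu : IsLeftHopfIntegral mu) :
    ∃ c : k, mu = c • lam := by
  let Θ : A →ₗ[k] Module.Dual k A :=
    ((LinearMap.mul k A).flip.compr₂ lam) ∘ₗ HopfAlgebra.antipode k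
  have hΘ : ∀ h, Θ h = lam ∘ₗ LinearMap.mulRight k (HopfAlgebra.antipode k h) :=
    fun h => by ext; rfl
  have hinj : Function.Injective Θ := (injective_iff_map_eq_zero Θ).2 fun h hh =>
    hlam.eq_zero_of_mul_antipode hne ((hΘ h).symm.trans hh)
  obtain ⟨h, hh⟩ := (LinearMap.injective_iff_surjective_of_finrank_eq_finrank
    Subspace.dual_finrank_eq.symm).1 hinj mu
  refine ⟨Coalgebra.counit h, LinearMap.ext fun x => ?_⟩
  have h₁ := hlam.traceForm_mul_antipode Coalgebra.counit h x
  have h₂ := hmu.traceForm_mul_antipode Coalgebra.counit 1 x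
  have h₃ : mu ∘ₗ LinearMap.mulRight k (HopfAlgebra.antipode k (1 : A)) = mu := by ext; simp
  rw [← hΘ, hh] at h₁
  rw [h₃, h₁] at h₂
  simpa using h₂.symm

theorem antipode_injective [FiniteDimensional k A] :
    Function.Injective (HopfAlgebra.antipode k : A →ₗ[k] A) := by
  obtain ⟨lam, hlam, hne⟩ := exists_isLeftHopfIntegral_ne_zero (k := k) (A := A)
  refine (injective_iff_map_eq_zero _).2 fun h hh => hlam.eq_zero_of_mul_antipode hne ?_
  ext; simp [hh]

/-- A right integral on a Hopf algebra. -/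
def IsRightHopfIntegral (mu : A →ₗ[k] k) : Prop :=
  ∀ x, leftSlice mu x = mu x • (1 : A)

theorem IsRightHopfIntegral.comp_antipode [FiniteDimensional k A] {mu : A →ₗ[k] k}
    (hmu : IsRightHopfIntegral mu) :
    IsLeftHopfIntegral (mu ∘ₗ HopfAlgebra.antipode k) := by
  intro x
  refine antipode_injective (k := k) ?_
  have h := hmu (HopfAlgebra.antipode k x)
  rw [leftSlice_apply _ (reprAntipode (ℛ k x))] at h
  rw [rightSlice_apply _ (ℛ k x)]
  simpa [reprAntipode] using h

theorem IsLeftHopfIntegral.comp_bialgHom {lam : A →ₗ[k] k} (hlam : IsLeftHopfIntegral lam)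
    (F : A →ₐc[k] A) (hF : Function.Injective F) :
    IsLeftHopfIntegral (lam ∘ₗ (F : A →ₗ[k] A)) := by
  intro x
  refine hF ?_
  have h := hlam (F x)
  have hr : rightSlice lam (F x) = F (rightSlice (lam ∘ₗ (F : A →ₗ[k] A)) x) := by
    rw [rightSlice_apply _ (ℛ k x)]
    have hc := (CoalgHomClass.map_comp_comul_apply F x).symm
    rw [← (ℛ k x).eq] at hc
    simp [rightSlice, hc]
  rw [← hr, h]
  simp

theorem antipode_bialgHom (F : A →ₐc[k] A) (x : A) :
    HopfAlgebra.antipode k (F x) = F (HopfAlgebra.antipode k x) := by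
  have h : WithConv.toConv ((F : A →ₗ[k] A) ∘ₗ HopfAlgebra.antipode k) =
      WithConv.toConv (HopfAlgebra.antipode k ∘ₗ (F : A →ₗ[k] A)) := by
    refine left_inv_eq_right_inv (a := WithConv.toConv (F : A →ₗ[k] A)) ?_ ?_
    · ext a
      have := congrArg F (sum_antipode_mul_eq_smul (ℛ k a))
      rw [(ℛ k a).convMul_apply]
      simpa [Algebra.algebraMap_eq_smul_one] using this
    · ext a
      have := mul_antipode_lTensor_comul_apply (R := k) (F a)
      rw [← CoalgHomClass.map_comp_comul_apply F a, ← (ℛ k a).eq] at this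
      rw [(ℛ k a).convMul_apply]
      simpa using this
  exact (congrArg (fun T => T.ofConv x) h).symm

theorem IsRightHopfIntegral.comp_bialgHom_eq [FiniteDimensional k A] {mu : A →ₗ[k] k}
    (hmu : IsRightHopfIntegral mu)
    (F : A →ₐc[k] A) (c : k)
    (hc : ∀ lam : A →ₗ[k] k, IsLeftHopfIntegral lam → ∀ x, lam (F x) = c * lam x) (x : A) :
    mu (F x) = c * mu x := by
  obtain ⟨y, rfl⟩ := LinearMap.injective_iff_surjective.1 (antipode_injective (k := k)) x
  rw [← antipode_bialgHom]
  exact hc _ hmu.comp_antipode y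

end HopfIntegrals

section CastFree

theorem gcast_trans_apply (k : Type*) [CommSemiring k] {π : Type*} (H : π → Type*)
    [∀ α, Ring (H α)] [∀ α, Algebra k (H α)] {a b c : π} (h : a = b) (h' : b = c) (x : H a) :
    gcast k H h' (gcast k H h x) = gcast k H (h.trans h') x := by
  subst h h'; rfl

variable (k : Type*) [Field k] {π : Type*} [Group π] (H : π → Type*)
  [∀ α, Ring (H α)] [∀ α, Algebra k (H α)]

section Hopf

variable [HopfGCoalgebra k H]

/-- The comultiplication `H c → H a ⊗ H b` for any index `c` equal to `a * b`. -/
def comulOf {a b c : π} (h : c = a * b) : H c →ₐ[k] H a ⊗[k] H b :=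
  (Δ a b).comp (gcast k H h).toAlgHom

/-- The antipode `H a → H b` for any index `a` equal to `b⁻¹`. -/
def antipodeOf {a b : π} (h : a = b⁻¹) : H a →ₗ[k] H b :=
  (gcast k H (inv_inv b)).toLinearMap ∘ₗ S b⁻¹ ∘ₗ (gcast k H h).toLinearMap

theorem comulOf_mul (a b : π) (x : H (a * b)) : comulOf k H rfl x = Δ a b x := rfl

theorem comulOf_coassoc {a b c ab bc abc : π} (h₁ : ab = a * b) (h₂ : bc = b * c)
    (h₃ : abc = ab * c) (h₄ : abc = a * bc) (x : H abc) :
    TensorProduct.assoc k (H a) (H b) (H c)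
        (TensorProduct.map (comulOf k H h₁).toLinearMap LinearMap.id (comulOf k H h₃ x))
      = TensorProduct.map LinearMap.id (comulOf k H h₂).toLinearMap (comulOf k H h₄ x) := by
  subst h₁ h₂ h₃
  exact LinearMap.congr_fun (coassoc (k := k) (H := H) a b c) x

theorem comulOf_counit_right {a : π} (h : a = a * 1) (x : H a) :
    TensorProduct.rid k (H a)
      (TensorProduct.map LinearMap.id (ε (k := k) (H := H)).toLinearMap (comulOf k H h x)) = x :=
  LinearMap.congr_fun (counit_right (k := k) (H := H) a) x

theorem comulOf_counit_left {a : π} (h : a = 1 * a) (x : H a) :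
    TensorProduct.lid k (H a)
      (TensorProduct.map (ε (k := k) (H := H)).toLinearMap LinearMap.id (comulOf k H h x)) = x :=
  LinearMap.congr_fun (counit_left (k := k) (H := H) a) x

theorem antipodeOf_mul_comulOf {a b : π} (h : a = b⁻¹) (h' : 1 = a * b) (x : H 1) :
    LinearMap.mul' k (H b)
        (TensorProduct.map (antipodeOf k H h) LinearMap.id (comulOf k H h' x))
      = algebraMap k (H b) (ε (k := k) (H := H) x) := by
  subst h
  refine (LinearMap.congr_fun (antipode_left (k := k) (H := H) b) (gcast k H h' x)).trans ?_
  exact congrArg (fun y => algebraMap k (H b) (ε y)) (gcast_trans_apply k H h' h'.symm x)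

theorem comulOf_mul_antipodeOf {a b : π} (h : a = b⁻¹) (h' : 1 = b * a) (x : H 1) :
    LinearMap.mul' k (H b)
        (TensorProduct.map LinearMap.id (antipodeOf k H h) (comulOf k H h' x))
      = algebraMap k (H b) (ε (k := k) (H := H) x) := by
  subst h
  refine (LinearMap.congr_fun (antipode_right (k := k) (H := H) b) (gcast k H h' x)).trans ?_
  exact congrArg (fun y => algebraMap k (H b) (ε y)) (gcast_trans_apply k H h' h'.symm x)

theorem antipodeOf_one {a b : π} (h : a = b⁻¹) : antipodeOf k H h 1 = 1 := by
  have := antipodeOf_mul_comulOf k H h (by rw [h, inv_mul_cancel]) 1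
  simpa [Algebra.TensorProduct.one_def] using this

variable {k H} in
theorem HopfGCoalgebra.IsLeftIntegral.comulOf_apply {lam : ∀ α : π, H α →ₗ[k] k}
    (hlam : IsLeftIntegral k H lam)
    {a b c : π} (h : c = a * b) (x : H c) :
    TensorProduct.rid k (H a) (TensorProduct.map LinearMap.id (lam b) (comulOf k H h x))
      = lam c x • (1 : H a) := by
  subst h; exact hlam a b x

variable {k H} in
theorem HopfGCoalgebra.IsRightIntegral.comulOf_apply {lam : ∀ α : π, H α →ₗ[k] k}
    (hlam : IsRightIntegral k H lam)
    {a b c : π} (h : c = a * b) (x : H c) :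
    TensorProduct.lid k (H b) (TensorProduct.map (lam a) LinearMap.id (comulOf k H h x))
      = lam c x • (1 : H b) := by
  subst h; exact hlam a b x

/-- The neutral component of a Hopf `π`-coalgebra is a Hopf algebra. -/
abbrev hopfAlgebraOne : HopfAlgebra k (H (1 : π)) :=
  letI : Bialgebra k (H (1 : π)) :=
    Bialgebra.ofAlgHom (comulOf k H (mul_one 1).symm) ε
      (AlgHom.ext fun x => comulOf_coassoc k H _ _ _ _ x)
      (AlgHom.ext fun x => (TensorProduct.lid k (H (1 : π))).injective <|
        (comulOf_counit_left k H (mul_one 1).symm x).trans (one_smul k x).symm)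
      (AlgHom.ext fun x => (TensorProduct.rid k (H (1 : π))).injective <|
        (comulOf_counit_right k H (mul_one 1).symm x).trans (one_smul k x).symm)
  { antipode := antipodeOf k H inv_one.symm
    mul_antipode_rTensor_comul :=
      LinearMap.ext fun x => antipodeOf_mul_comulOf k H inv_one.symm (mul_one 1).symm x
    mul_antipode_lTensor_comul :=
      LinearMap.ext fun x => comulOf_mul_antipodeOf k H inv_one.symm (mul_one 1).symm x }

end Hopf

section Crossed

variable [CrossedHopfGCoalgebra k H]

/-- The crossing `H a → H b` for any index `b` equal to `β * a * β⁻¹`. -/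
def crossingOf (β : π) {a b : π} (h : β * a * β⁻¹ = b) : H a ≃ₐ[k] H b :=
  (φ β a).trans (gcast k H h)

theorem comulOf_crossingOf (β : π) {a b c a' b' c' : π} (h : c = a * b) (h' : c' = a' * b')
    (ha : β * a * β⁻¹ = a') (hb : β * b * β⁻¹ = b') (hc : β * c * β⁻¹ = c') (x : H c) :
    comulOf k H h' (crossingOf k H β hc x)
      = TensorProduct.map (crossingOf k H β ha).toLinearMap (crossingOf k H β hb).toLinearMap
          (comulOf k H h x) := by
  subst h ha hb hc
  exact (LinearMap.congr_fun (φ_comul (k := k) (H := H) β a b) x).symm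

theorem crossingOf_mul (β β' : π) {a b c : π} (h : β' * a * β'⁻¹ = b) (h' : β * b * β⁻¹ = c)
    (h'' : β * β' * a * (β * β')⁻¹ = c) (x : H a) :
    crossingOf k H β h' (crossingOf k H β' h x) = crossingOf k H (β * β') h'' x := by
  subst h h'
  exact (gcast_trans_apply k H h''.symm h'' _).symm.trans
    (congrArg (gcast k H h'') (φ_mul (k := k) β β' a x))

/-- The crossing restricted to the neutral component, as a bialgebra homomorphism. -/
def crossingOne (β : π) :
    letI := hopfAlgebraOne k H
    H (1 : π) →ₐc[k] H (1 : π) :=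
  letI := hopfAlgebraOne k H
  BialgHom.ofAlgHom (crossingOf k H β (by group)).toAlgHom
    (AlgHom.ext fun x => φ_counit β x)
    (AlgHom.ext fun x => (comulOf_crossingOf k H β _ _ _ _ _ x).symm)

end Crossed

section NeutralComponent

variable [HopfGCoalgebra k H]

/-- A linear form on `H 1` is a left integral for the Hopf algebra `H 1`. -/
def IsLeftIntegralOne (f : H (1 : π) →ₗ[k] k) : Prop :=
  letI := hopfAlgebraOne k H
  IsLeftHopfIntegral f

/-- A linear form on `H 1` is a right integral for the Hopf algebra `H 1`. -/
def IsRightIntegralOne (f : H (1 : π) →ₗ[k] k) : Prop :=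
  letI := hopfAlgebraOne k H
  IsRightHopfIntegral f

variable {k H}

theorem IsLeftIntegralOne.comulOf_apply {f : H (1 : π) →ₗ[k] k} (hf : IsLeftIntegralOne k H f)
    (x : H (1 : π)) :
    TensorProduct.rid k (H 1)
      (TensorProduct.map LinearMap.id f (comulOf k H (mul_one 1).symm x)) = f x • 1 :=
  hf x

theorem HopfGCoalgebra.IsLeftIntegral.one {lam : ∀ α : π, H α →ₗ[k] k}
    (hlam : IsLeftIntegral k H lam) :
    IsLeftIntegralOne k H (lam 1) :=
  fun x => hlam.comulOf_apply (mul_one 1).symm x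

theorem HopfGCoalgebra.IsRightIntegral.one {lam : ∀ α : π, H α →ₗ[k] k}
    (hlam : IsRightIntegral k H lam) :
    IsRightIntegralOne k H (lam 1) :=
  fun x => hlam.comulOf_apply (mul_one 1).symm x

variable (k H) in
theorem exists_isLeftIntegralOne_ne_zero [FiniteDimensional k (H (1 : π))] :
    ∃ f : H (1 : π) →ₗ[k] k, IsLeftIntegralOne k H f ∧ f ≠ 0 :=
  letI := hopfAlgebraOne k H
  exists_isLeftHopfIntegral_ne_zero (k := k) (A := H 1)

theorem IsLeftIntegralOne.exists_eq_smul [FiniteDimensional k (H (1 : π))]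
    {f g : H (1 : π) →ₗ[k] k} (hf : IsLeftIntegralOne k H f) (hne : f ≠ 0)
    (hg : IsLeftIntegralOne k H g) : ∃ c : k, g = c • f :=
  letI := hopfAlgebraOne k H
  IsLeftHopfIntegral.exists_eq_smul hf hne hg

end NeutralComponent

theorem exists_dual_smul_one (k A : Type*) [Field k] [Ring A] [Algebra k A] :
    ∃ g : A →ₗ[k] k, ∀ y : A, (1 : A) ⊗ₜ[k] y = y ⊗ₜ[k] (1 : A) → y = g y • 1 := by
  rcases subsingleton_or_nontrivial A with h | h
  · exact ⟨0, fun y _ => Subsingleton.elim _ _⟩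
  · obtain ⟨g, hg⟩ := Module.Projective.exists_dual_eq_one k (one_ne_zero (α := A))
    refine ⟨g, fun y hy => ?_⟩
    have := congrArg (TensorProduct.lid k A ∘ TensorProduct.map g LinearMap.id) hy
    simpa [hg] using this

theorem nontrivial_one (k : Type*) [Field k] {π : Type*} [Group π] {H : π → Type*}
    [∀ α, Ring (H α)] [∀ α, Algebra k (H α)] [HopfGCoalgebra k H] : Nontrivial (H (1 : π)) :=
  (ε (k := k) (H := H)).toRingHom.domain_nontrivial

theorem nontrivial_inv (k : Type*) [Field k] {π : Type*} [Group π] {H : π → Type*}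
    [∀ α, Ring (H α)] [∀ α, Algebra k (H α)] [HopfGCoalgebra k H]
    (a : π) [Nontrivial (H a)] : Nontrivial (H a⁻¹) := by
  by_contra h
  rw [not_nontrivial_iff_subsingleton] at h
  refine one_ne_zero (α := H a) ?_
  rw [← antipodeOf_one k H (rfl : a⁻¹ = a⁻¹), Subsingleton.elim (1 : H a⁻¹) 0, map_zero]

theorem nontrivial_of_mul_left (k : Type*) [Field k] {π : Type*} [Group π] {H : π → Type*}
    [∀ α, Ring (H α)] [∀ α, Algebra k (H α)] [HopfGCoalgebra k H]
    (a b : π) [Nontrivial (H a)] [Nontrivial (H (a * b))] : Nontrivial (H b) := by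
  have := nontrivial_inv k (H := H) a
  exact (comulOf k H (by group : b = a⁻¹ * (a * b))).toRingHom.domain_nontrivial


section LeftIntegralExistence

variable {k H} [HopfGCoalgebra k H]

/-- The operator `x ↦ f(x₂) x₁` on `H a`, for a linear form `f` on `H 1`. -/
def rightSliceOf (f : H (1 : π) →ₗ[k] k) (a : π) : H a →ₗ[k] H a :=
  (TensorProduct.rid k (H a)).toLinearMap ∘ₗ TensorProduct.map LinearMap.id f ∘ₗ
    (comulOf k H (mul_one a).symm).toLinearMap

theorem comulOf_rightSliceOf (f : H (1 : π) →ₗ[k] k) {a b c : π} (h : c = a * b) (x : H c) :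
    comulOf k H h (rightSliceOf f c x) =
      TensorProduct.map LinearMap.id (rightSliceOf f b) (comulOf k H h x) := by
  have key := congrArg (TensorProduct.map LinearMap.id ((TensorProduct.rid k (H b)).toLinearMap ∘ₗ
    TensorProduct.map LinearMap.id f)) (comulOf_coassoc k H h (mul_one b).symm
      (mul_one c).symm h x)
  rw [TensorProduct.map_map] at key
  refine Eq.trans ?_ key
  suffices H' : ∀ t : H c ⊗[k] H (1 : π),
      comulOf k H h (TensorProduct.rid k (H c) (TensorProduct.map LinearMap.id f t)) =
      TensorProduct.map LinearMap.id ((TensorProduct.rid k (H b)).toLinearMap ∘ₗ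
        TensorProduct.map LinearMap.id f) (TensorProduct.assoc k (H a) (H b) (H 1)
        (TensorProduct.map (comulOf k H h).toLinearMap LinearMap.id t)) from H' _
  intro t
  induction t with
  | zero => simp
  | add s t hs ht => simp only [map_add, hs, ht]
  | tmul y z =>
    simp only [TensorProduct.map_tmul, TensorProduct.rid_tmul, map_smul, LinearMap.id_apply,
      AlgHom.toLinearMap_apply]
    induction comulOf k H h y with
    | zero => simp
    | add s t hs ht => simp only [map_add, hs, ht, TensorProduct.add_tmul, smul_add]
    | tmul u v => simp

theorem IsLeftIntegralOne.comulOf_rightSliceOf_one {f : H (1 : π) →ₗ[k] k}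
    (hf : IsLeftIntegralOne k H f) (a : π) (x : H a) :
    comulOf k H (mul_one a).symm (rightSliceOf f a x) = rightSliceOf f a x ⊗ₜ[k] 1 := by
  rw [comulOf_rightSliceOf]
  simp only [rightSliceOf, LinearMap.comp_apply, AlgHom.toLinearMap_apply,
    LinearEquiv.coe_coe]
  induction comulOf k H (mul_one a).symm x with
  | zero => simp
  | add s t hs ht => simp only [map_add, hs, ht, TensorProduct.add_tmul]
  | tmul y z => simp [hf.comulOf_apply, TensorProduct.smul_tmul]

theorem one_tmul_eq_tmul_one {a : π} {y : H a}
    (hy : comulOf k H (mul_one a).symm y = y ⊗ₜ[k] 1) :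
    (1 : H a) ⊗ₜ[k] y = y ⊗ₜ[k] (1 : H a) := by
  let T : H a ⊗[k] (H a⁻¹ ⊗[k] H a) →ₗ[k] H a ⊗[k] H a :=
    TensorProduct.map (LinearMap.mul' k (H a) ∘ₗ TensorProduct.map LinearMap.id
      (antipodeOf k H rfl)) LinearMap.id ∘ₗ (TensorProduct.assoc k _ _ _).symm.toLinearMap
  have key := congrArg T (comulOf_coassoc k H (mul_inv_cancel a).symm (inv_mul_cancel a).symm
    (one_mul a).symm (mul_one a).symm y)
  have h₁ : ∀ t : H (1 : π) ⊗[k] H a, T (TensorProduct.assoc k _ _ _ (TensorProduct.map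
      (comulOf k H (mul_inv_cancel a).symm).toLinearMap LinearMap.id t)) =
      1 ⊗ₜ[k] TensorProduct.lid k (H a) (TensorProduct.map
        (ε (k := k) (H := H)).toLinearMap LinearMap.id t) := by
    intro t
    induction t with
    | zero => simp
    | add s t hs ht => simp only [map_add, hs, ht, TensorProduct.tmul_add]
    | tmul u v =>
      simp [T, comulOf_mul_antipodeOf, Algebra.algebraMap_eq_smul_one, TensorProduct.smul_tmul]
  rw [h₁, comulOf_counit_left, hy] at key
  simpa [T, Algebra.TensorProduct.one_def, antipodeOf_one] using key

/-- Every left integral of the neutral component extends to a left `π`-integral. -/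
theorem IsLeftIntegralOne.exists_isLeftIntegral {f : H (1 : π) →ₗ[k] k}
    (hf : IsLeftIntegralOne k H f) :
    ∃ lam : ∀ α : π, H α →ₗ[k] k, IsLeftIntegral k H lam ∧ lam 1 = f := by
  choose g hg using fun a : π => exists_dual_smul_one k (H a)
  have hslice (a : π) (x : H a) : rightSliceOf f a x = g a (rightSliceOf f a x) • 1 :=
    hg a _ (one_tmul_eq_tmul_one (hf.comulOf_rightSliceOf_one a x))
  refine ⟨fun a => g a ∘ₗ rightSliceOf f a, fun a b x => ?_, ?_⟩
  · rcases subsingleton_or_nontrivial (H a) with ha | ha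
    · exact Subsingleton.elim _ _
    rcases subsingleton_or_nontrivial (H (a * b)) with hab | hab
    · rw [Subsingleton.elim x 0]; simp
    have hb := nontrivial_of_mul_left k (H := H) a b
    have hgb : g b 1 = 1 :=
      (smul_left_injective k (one_ne_zero (α := H b)) <| by simpa using hg b 1 rfl).symm
    have key := congrArg (TensorProduct.rid k (H a) ∘ TensorProduct.map LinearMap.id (g b))
      (comulOf_rightSliceOf f (rfl : a * b = a * b) x)
    rw [hslice, map_smul, map_one, Algebra.TensorProduct.one_def] at key
    simp only [Function.comp_apply, TensorProduct.map_map] at key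
    simpa [hgb, comulOf_mul] using key.symm
  · ext x
    have hx : rightSliceOf f 1 x = f x • 1 := hf.comulOf_apply x
    have := nontrivial_one k (H := H)
    have h1 := hslice 1 x
    rw [hx] at h1
    simpa [hx] using (smul_left_injective k (one_ne_zero (α := H (1 : π))) h1).symm

end LeftIntegralExistence

section CrossingCharacter

variable {k H} [CrossedHopfGCoalgebra k H]

theorem IsLeftIntegralOne.comp_crossingOf {f : H (1 : π) →ₗ[k] k}
    (hf : IsLeftIntegralOne k H f) (β : π) (h : β * 1 * β⁻¹ = 1) :
    IsLeftIntegralOne k H (f ∘ₗ (crossingOf k H β h).toLinearMap) :=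
  letI := hopfAlgebraOne k H
  IsLeftHopfIntegral.comp_bialgHom hf (crossingOne k H β) (crossingOf k H β h).injective

theorem IsRightIntegralOne.crossingOf_apply_eq [FiniteDimensional k (H (1 : π))]
    {f : H (1 : π) →ₗ[k] k} (hf : IsRightIntegralOne k H f) {β : π} (h : β * 1 * β⁻¹ = 1) {c : k}
    (hc : ∀ g : H (1 : π) →ₗ[k] k, IsLeftIntegralOne k H g →
      ∀ x, g (crossingOf k H β h x) = c * g x) (x : H (1 : π)) :
    f (crossingOf k H β h x) = c * f x :=
  letI := hopfAlgebraOne k H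
  IsRightHopfIntegral.comp_bialgHom_eq hf (crossingOne k H β) c hc x

variable (k H) in
/-- The scalar by which the crossing acts on left integrals of the neutral component. -/
theorem exists_crossing_character [FiniteDimensional k (H (1 : π))] :
    ∃ χ : π →* kˣ, ∀ f : H (1 : π) →ₗ[k] k, IsLeftIntegralOne k H f →
      ∀ (β : π) (h : β * 1 * β⁻¹ = 1) (x : H 1),
        f (crossingOf k H β h x) = (χ β : k) * f x := by
  obtain ⟨f, hf, hne⟩ := exists_isLeftIntegralOne_ne_zero k H
  obtain ⟨x₀, hx₀⟩ : ∃ x, f x ≠ 0 := by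
    by_contra! hx
    exact hne (LinearMap.ext hx)
  have hone (β : π) : β * 1 * β⁻¹ = 1 := by group
  choose c hc using fun β => hf.exists_eq_smul hne (hf.comp_crossingOf β (hone β))
  replace hc (β : π) (x : H 1) : f (crossingOf k H β (hone β) x) = c β * f x :=
    LinearMap.congr_fun (hc β) x
  have hmul (β β' : π) : c (β * β') = c β * c β' := by
    refine mul_right_cancel₀ hx₀ ?_
    rw [← hc, ← crossingOf_mul k H β β' (hone β') (hone β) (hone _), hc, hc, mul_assoc]
  have hc₀ (β : π) : c β ≠ 0 := fun h => by
    have := hc β ((crossingOf k H β (hone β)).symm x₀)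
    rw [AlgEquiv.apply_symm_apply, h, zero_mul] at this
    exact hx₀ this
  refine ⟨MonoidHom.mk' (fun β => Units.mk0 (c β) (hc₀ β)) fun β β' => Units.ext (hmul β β'),
    fun g hg β h x => ?_⟩
  obtain ⟨d, rfl⟩ := hf.exists_eq_smul hne hg
  simp [hc, mul_left_comm]

theorem HopfGCoalgebra.IsLeftIntegral.crossing_apply {lam : ∀ α : π, H α →ₗ[k] k}
    (hlam : IsLeftIntegral k H lam) {β : π} {c : k}
    (hc : ∀ (h : β * 1 * β⁻¹ = 1) (x : H 1), lam 1 (crossingOf k H β h x) = c * lam 1 x)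
    (α : π) (x : H α) : lam (β * α * β⁻¹) (crossing k H β α x) = c * lam α x := by
  rcases subsingleton_or_nontrivial (H (β * α * β⁻¹)) with hα | hα
  · rw [(crossing k H β α).injective (Subsingleton.elim (crossing k H β α x) _ : _ =
      crossing k H β α 0)]
    simp
  refine smul_left_injective k (one_ne_zero (α := H (β * α * β⁻¹))) ?_
  have hx := hlam.comulOf_apply (mul_one α).symm x
  have key : TensorProduct.rid k _ (TensorProduct.map LinearMap.id (lam 1)
      (comulOf k H (mul_one (β * α * β⁻¹)).symm (crossingOf k H β rfl x))) =
      c • crossingOf k H β rfl (TensorProduct.rid k _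
        (TensorProduct.map LinearMap.id (lam 1) (comulOf k H (mul_one α).symm x))) := by
    rw [comulOf_crossingOf k H β (mul_one α).symm _ rfl (by group) rfl]
    induction comulOf k H (mul_one α).symm x with
    | zero => simp
    | add s t hs ht => simp only [map_add, hs, ht, smul_add]
    | tmul u v => simp [hc, mul_smul]
  rw [hlam.comulOf_apply, hx, map_smul, map_one, smul_smul] at key
  exact key

theorem HopfGCoalgebra.IsRightIntegral.crossing_apply {lam : ∀ α : π, H α →ₗ[k] k}
    (hlam : IsRightIntegral k H lam) {β : π} {c : k}
    (hc : ∀ (h : β * 1 * β⁻¹ = 1) (x : H 1), lam 1 (crossingOf k H β h x) = c * lam 1 x)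
    (α : π) (x : H α) : lam (β * α * β⁻¹) (crossing k H β α x) = c * lam α x := by
  rcases subsingleton_or_nontrivial (H (β * α * β⁻¹)) with hα | hα
  · rw [(crossing k H β α).injective (Subsingleton.elim (crossing k H β α x) _ : _ =
      crossing k H β α 0)]
    simp
  refine smul_left_injective k (one_ne_zero (α := H (β * α * β⁻¹))) ?_
  have hx := hlam.comulOf_apply (one_mul α).symm x
  have key : TensorProduct.lid k _ (TensorProduct.map (lam 1) LinearMap.id
      (comulOf k H (one_mul (β * α * β⁻¹)).symm (crossingOf k H β rfl x))) =
      c • crossingOf k H β rfl (TensorProduct.lid k _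
        (TensorProduct.map (lam 1) LinearMap.id (comulOf k H (one_mul α).symm x))) := by
    rw [comulOf_crossingOf k H β (one_mul α).symm _ (by group) rfl rfl]
    induction comulOf k H (one_mul α).symm x with
    | zero => simp
    | add s t hs ht => simp only [map_add, hs, ht, smul_add]
    | tmul u v => simp [hc, mul_smul]
  rw [hlam.comulOf_apply, hx, map_smul, map_one, smul_smul] at key
  exact key

end CrossingCharacter

end CastFree

/-- Corollary 6.2: for a finite dimensional crossed Hopf `π`-coalgebra there is a
unique group homomorphism `φ̂ : π → kˣ` with `λ_{βαβ⁻¹} ∘ φ_β = φ̂(β) λ_α` for every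
left or right `π`-integral `λ`. -/
theorem crossing_character_exists_unique (k : Type*) [Field k] {π : Type*} [Group π]
    (H : π → Type*) [∀ α, Ring (H α)] [∀ α, Algebra k (H α)]
    [CrossedHopfGCoalgebra k H] [∀ α, FiniteDimensional k (H α)] :
    ∃! φh : π →* kˣ,
      ∀ lam : ∀ α : π, H α →ₗ[k] k,
        IsLeftIntegral k H lam ∨ IsRightIntegral k H lam →
        ∀ (α β : π) (x : H α),
          lam (β * α * β⁻¹) (crossing k H β α x) = (φh β : k) * lam α x := by
  obtain ⟨χ, hχ⟩ := exists_crossing_character k H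
  refine ⟨χ, ?_, fun ψ hψ => MonoidHom.ext fun β => Units.ext ?_⟩
  · rintro lam (hlam | hlam) α β x
    · exact hlam.crossing_apply (hχ _ hlam.one β) α x
    · exact hlam.crossing_apply
        (fun h => hlam.one.crossingOf_apply_eq h fun g hg => hχ g hg β h) α x
  · obtain ⟨f, hf, hne⟩ := exists_isLeftIntegralOne_ne_zero k H
    obtain ⟨lam, hlam, rfl⟩ := hf.exists_isLeftIntegral
    obtain ⟨x, hx⟩ : ∃ x, lam 1 x ≠ 0 := by
      by_contra! hx
      exact hne (LinearMap.ext hx)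
    refine mul_right_cancel₀ hx ?_
    rw [← hψ lam (Or.inl hlam) 1 β x, hlam.crossing_apply (hχ _ hf β) 1 x]
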